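/- For any family N of 2D-PI kernels of size n2×p2 and any family E of (011→2D)-PI kernels of size p2×(m0,m1), there exists a family T of (011→2D)-PI kernels of size n2×(m0,m1) such that for every triple (v, u1, u2) with v ∈ ℝ^{m0} and continuous u1 : [a,b] → ℝ^{m1}, u2 : [c,d] → ℝ^{m1}, and every (x,y) ∈ [a,b]×[c,d], (P[N](P[E](v,u1,u2)))(x,y) = (P[T](v,u1,u2))(x,y). -/

import Mathlib

open Matrix MeasureTheory Set

noncomputable section

/-- A family of 1D-PI kernels of size `p × r` (the parameters of a 1D-PI operator). -/
structure PI1DK (p r : ℕ) where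
  k0 : ℝ → Matrix (Fin p) (Fin r) ℝ
  k1 : ℝ → ℝ → Matrix (Fin p) (Fin r) ℝ
  k2 : ℝ → ℝ → Matrix (Fin p) (Fin r) ℝ

/-- Continuity of a family of 1D-PI kernels on the interval `[s,t]`. -/
def PI1DK.IsCont {p r : ℕ} (s t : ℝ) (N : PI1DK p r) : Prop :=
  ContinuousOn N.k0 (Icc s t) ∧
  ContinuousOn (fun q : ℝ × ℝ => N.k1 q.1 q.2) (Icc s t ×ˢ Icc s t) ∧
  ContinuousOn (fun q : ℝ × ℝ => N.k2 q.1 q.2) (Icc s t ×ˢ Icc s t)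

/-- The 1D-PI operator on `[s,t]` associated with the kernels `N`. -/
def PI1D {p r : ℕ} (s t : ℝ) (N : PI1DK p r) (u : ℝ → Fin r → ℝ) (x : ℝ) :
    Fin p → ℝ :=
  N.k0 x *ᵥ u x + (∫ θ in s..x, N.k1 x θ *ᵥ u θ) + (∫ θ in x..t, N.k2 x θ *ᵥ u θ)

/-- Entrywise interval integral of a matrix-valued function. -/
def mInt {p r : ℕ} (s t : ℝ) (F : ℝ → Matrix (Fin p) (Fin r) ℝ) :
    Matrix (Fin p) (Fin r) ℝ :=
  Matrix.of fun i j => ∫ η in s..t, F η i j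

/-- A family of 2D-PI kernels of size `p × r`. -/
structure PI2DK (p r : ℕ) where
  k00 : ℝ → ℝ → Matrix (Fin p) (Fin r) ℝ
  k10 : ℝ → ℝ → ℝ → Matrix (Fin p) (Fin r) ℝ
  k20 : ℝ → ℝ → ℝ → Matrix (Fin p) (Fin r) ℝ
  k01 : ℝ → ℝ → ℝ → Matrix (Fin p) (Fin r) ℝ
  k02 : ℝ → ℝ → ℝ → Matrix (Fin p) (Fin r) ℝ
  k11 : ℝ → ℝ → ℝ → ℝ → Matrix (Fin p) (Fin r) ℝ
  k21 : ℝ → ℝ → ℝ → ℝ → Matrix (Fin p) (Fin r) ℝ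
  k12 : ℝ → ℝ → ℝ → ℝ → Matrix (Fin p) (Fin r) ℝ
  k22 : ℝ → ℝ → ℝ → ℝ → Matrix (Fin p) (Fin r) ℝ

/-- Continuity of a family of 2D-PI kernels on `[a,b] × [c,d]`. -/
def PI2DK.IsCont {p r : ℕ} (a b c d : ℝ) (N : PI2DK p r) : Prop :=
  ContinuousOn (fun q : ℝ × ℝ => N.k00 q.1 q.2) (Icc a b ×ˢ Icc c d) ∧
  ContinuousOn (fun q : ℝ × ℝ × ℝ => N.k10 q.1 q.2.1 q.2.2)
    (Icc a b ×ˢ Icc c d ×ˢ Icc a b) ∧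
  ContinuousOn (fun q : ℝ × ℝ × ℝ => N.k20 q.1 q.2.1 q.2.2)
    (Icc a b ×ˢ Icc c d ×ˢ Icc a b) ∧
  ContinuousOn (fun q : ℝ × ℝ × ℝ => N.k01 q.1 q.2.1 q.2.2)
    (Icc a b ×ˢ Icc c d ×ˢ Icc c d) ∧
  ContinuousOn (fun q : ℝ × ℝ × ℝ => N.k02 q.1 q.2.1 q.2.2)
    (Icc a b ×ˢ Icc c d ×ˢ Icc c d) ∧
  ContinuousOn (fun q : ℝ × ℝ × ℝ × ℝ => N.k11 q.1 q.2.1 q.2.2.1 q.2.2.2)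
    (Icc a b ×ˢ Icc c d ×ˢ Icc a b ×ˢ Icc c d) ∧
  ContinuousOn (fun q : ℝ × ℝ × ℝ × ℝ => N.k21 q.1 q.2.1 q.2.2.1 q.2.2.2)
    (Icc a b ×ˢ Icc c d ×ˢ Icc a b ×ˢ Icc c d) ∧
  ContinuousOn (fun q : ℝ × ℝ × ℝ × ℝ => N.k12 q.1 q.2.1 q.2.2.1 q.2.2.2)
    (Icc a b ×ˢ Icc c d ×ˢ Icc a b ×ˢ Icc c d) ∧
  ContinuousOn (fun q : ℝ × ℝ × ℝ × ℝ => N.k22 q.1 q.2.1 q.2.2.1 q.2.2.2)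
    (Icc a b ×ˢ Icc c d ×ˢ Icc a b ×ˢ Icc c d)

/-- The 2D-PI operator on `[a,b] × [c,d]` associated with the kernels `N`. -/
def PI2D {p r : ℕ} (a b c d : ℝ) (N : PI2DK p r) (u : ℝ → ℝ → Fin r → ℝ)
    (x y : ℝ) : Fin p → ℝ :=
  N.k00 x y *ᵥ u x y
  + (∫ θ in a..x, N.k10 x y θ *ᵥ u θ y)
  + (∫ θ in x..b, N.k20 x y θ *ᵥ u θ y)
  + (∫ ν in c..y, N.k01 x y ν *ᵥ u x ν)
  + (∫ ν in y..d, N.k02 x y ν *ᵥ u x ν)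
  + (∫ θ in a..x, ∫ ν in c..y, N.k11 x y θ ν *ᵥ u θ ν)
  + (∫ θ in x..b, ∫ ν in c..y, N.k21 x y θ ν *ᵥ u θ ν)
  + (∫ θ in a..x, ∫ ν in y..d, N.k12 x y θ ν *ᵥ u θ ν)
  + (∫ θ in x..b, ∫ ν in y..d, N.k22 x y θ ν *ᵥ u θ ν)

/-- A family of 011-PI kernels of size `(p0,p1) × (r0,r1)`. -/
structure PI011K (p0 p1 r0 r1 : ℕ) where
  b00 : Matrix (Fin p0) (Fin r0) ℝ
  b01 : ℝ → Matrix (Fin p0) (Fin r1) ℝ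
  b02 : ℝ → Matrix (Fin p0) (Fin r1) ℝ
  b10 : ℝ → Matrix (Fin p1) (Fin r0) ℝ
  b20 : ℝ → Matrix (Fin p1) (Fin r0) ℝ
  b12 : ℝ → ℝ → Matrix (Fin p1) (Fin r1) ℝ
  b21 : ℝ → ℝ → Matrix (Fin p1) (Fin r1) ℝ
  b11 : PI1DK p1 r1
  b22 : PI1DK p1 r1

/-- Continuity of a family of 011-PI kernels. -/
def PI011K.IsCont {p0 p1 r0 r1 : ℕ} (a b c d : ℝ) (B : PI011K p0 p1 r0 r1) : Prop :=
  ContinuousOn B.b01 (Icc a b) ∧ ContinuousOn B.b02 (Icc c d) ∧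
  ContinuousOn B.b10 (Icc a b) ∧ ContinuousOn B.b20 (Icc c d) ∧
  ContinuousOn (fun q : ℝ × ℝ => B.b12 q.1 q.2) (Icc a b ×ˢ Icc c d) ∧
  ContinuousOn (fun q : ℝ × ℝ => B.b21 q.1 q.2) (Icc c d ×ˢ Icc a b) ∧
  B.b11.IsCont a b ∧ B.b22.IsCont c d

/-- The 011-PI operator associated with the kernels `B`. -/
def PI011 {p0 p1 r0 r1 : ℕ} (a b c d : ℝ) (B : PI011K p0 p1 r0 r1)
    (v : Fin r0 → ℝ) (u1 u2 : ℝ → Fin r1 → ℝ) :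
    (Fin p0 → ℝ) × (ℝ → Fin p1 → ℝ) × (ℝ → Fin p1 → ℝ) :=
  ( B.b00 *ᵥ v + (∫ θ in a..b, B.b01 θ *ᵥ u1 θ) + (∫ ν in c..d, B.b02 ν *ᵥ u2 ν),
    fun x => B.b10 x *ᵥ v + PI1D a b B.b11 u1 x + (∫ ν in c..d, B.b12 x ν *ᵥ u2 ν),
    fun y => B.b20 y *ᵥ v + (∫ θ in a..b, B.b21 y θ *ᵥ u1 θ) + PI1D c d B.b22 u2 y )

/-- A family of (2D→011)-PI kernels of size `(p0,p1) × r`. -/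
structure PI2Dto011K (p0 p1 r : ℕ) where
  d0 : ℝ → ℝ → Matrix (Fin p0) (Fin r) ℝ
  d10 : ℝ → ℝ → Matrix (Fin p1) (Fin r) ℝ
  d11 : ℝ → ℝ → ℝ → Matrix (Fin p1) (Fin r) ℝ
  d12 : ℝ → ℝ → ℝ → Matrix (Fin p1) (Fin r) ℝ
  d20 : ℝ → ℝ → Matrix (Fin p1) (Fin r) ℝ
  d21 : ℝ → ℝ → ℝ → Matrix (Fin p1) (Fin r) ℝ
  d22 : ℝ → ℝ → ℝ → Matrix (Fin p1) (Fin r) ℝ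

/-- Continuity of a family of (2D→011)-PI kernels. -/
def PI2Dto011K.IsCont {p0 p1 r : ℕ} (a b c d : ℝ) (D : PI2Dto011K p0 p1 r) : Prop :=
  ContinuousOn (fun q : ℝ × ℝ => D.d0 q.1 q.2) (Icc a b ×ˢ Icc c d) ∧
  ContinuousOn (fun q : ℝ × ℝ => D.d10 q.1 q.2) (Icc a b ×ˢ Icc c d) ∧
  ContinuousOn (fun q : ℝ × ℝ × ℝ => D.d11 q.1 q.2.1 q.2.2)
    (Icc a b ×ˢ Icc c d ×ˢ Icc a b) ∧
  ContinuousOn (fun q : ℝ × ℝ × ℝ => D.d12 q.1 q.2.1 q.2.2)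
    (Icc a b ×ˢ Icc c d ×ˢ Icc a b) ∧
  ContinuousOn (fun q : ℝ × ℝ => D.d20 q.1 q.2) (Icc a b ×ˢ Icc c d) ∧
  ContinuousOn (fun q : ℝ × ℝ × ℝ => D.d21 q.1 q.2.1 q.2.2)
    (Icc a b ×ˢ Icc c d ×ˢ Icc c d) ∧
  ContinuousOn (fun q : ℝ × ℝ × ℝ => D.d22 q.1 q.2.1 q.2.2)
    (Icc a b ×ˢ Icc c d ×ˢ Icc c d)

/-- The (2D→011)-PI operator associated with the kernels `D`. -/
def PI2Dto011 {p0 p1 r : ℕ} (a b c d : ℝ) (D : PI2Dto011K p0 p1 r)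
    (u : ℝ → ℝ → Fin r → ℝ) :
    (Fin p0 → ℝ) × (ℝ → Fin p1 → ℝ) × (ℝ → Fin p1 → ℝ) :=
  ( ∫ θ in a..b, ∫ ν in c..d, D.d0 θ ν *ᵥ u θ ν,
    fun x => ∫ y in c..d,
      (D.d10 x y *ᵥ u x y + (∫ θ in a..x, D.d11 x y θ *ᵥ u θ y)
        + (∫ θ in x..b, D.d12 x y θ *ᵥ u θ y)),
    fun y => ∫ x in a..b,
      (D.d20 x y *ᵥ u x y + (∫ ν in c..y, D.d21 x y ν *ᵥ u x ν)
        + (∫ ν in y..d, D.d22 x y ν *ᵥ u x ν)) )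

/-- A family of (011→2D)-PI kernels of size `p × (r0,r1)`. -/
structure PI011to2DK (p r0 r1 : ℕ) where
  e0 : ℝ → ℝ → Matrix (Fin p) (Fin r0) ℝ
  e10 : ℝ → ℝ → Matrix (Fin p) (Fin r1) ℝ
  e11 : ℝ → ℝ → ℝ → Matrix (Fin p) (Fin r1) ℝ
  e12 : ℝ → ℝ → ℝ → Matrix (Fin p) (Fin r1) ℝ
  e20 : ℝ → ℝ → Matrix (Fin p) (Fin r1) ℝ
  e21 : ℝ → ℝ → ℝ → Matrix (Fin p) (Fin r1) ℝ
  e22 : ℝ → ℝ → ℝ → Matrix (Fin p) (Fin r1) ℝ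

/-- Continuity of a family of (011→2D)-PI kernels. -/
def PI011to2DK.IsCont {p r0 r1 : ℕ} (a b c d : ℝ) (E : PI011to2DK p r0 r1) : Prop :=
  ContinuousOn (fun q : ℝ × ℝ => E.e0 q.1 q.2) (Icc a b ×ˢ Icc c d) ∧
  ContinuousOn (fun q : ℝ × ℝ => E.e10 q.1 q.2) (Icc a b ×ˢ Icc c d) ∧
  ContinuousOn (fun q : ℝ × ℝ × ℝ => E.e11 q.1 q.2.1 q.2.2)
    (Icc a b ×ˢ Icc c d ×ˢ Icc a b) ∧
  ContinuousOn (fun q : ℝ × ℝ × ℝ => E.e12 q.1 q.2.1 q.2.2)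
    (Icc a b ×ˢ Icc c d ×ˢ Icc a b) ∧
  ContinuousOn (fun q : ℝ × ℝ => E.e20 q.1 q.2) (Icc a b ×ˢ Icc c d) ∧
  ContinuousOn (fun q : ℝ × ℝ × ℝ => E.e21 q.1 q.2.1 q.2.2)
    (Icc a b ×ˢ Icc c d ×ˢ Icc c d) ∧
  ContinuousOn (fun q : ℝ × ℝ × ℝ => E.e22 q.1 q.2.1 q.2.2)
    (Icc a b ×ˢ Icc c d ×ˢ Icc c d)

/-- The (011→2D)-PI operator associated with the kernels `E`. -/
def PI011to2D {p r0 r1 : ℕ} (a b c d : ℝ) (E : PI011to2DK p r0 r1)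
    (v : Fin r0 → ℝ) (u1 u2 : ℝ → Fin r1 → ℝ) (x y : ℝ) : Fin p → ℝ :=
  E.e0 x y *ᵥ v + E.e10 x y *ᵥ u1 x
  + (∫ θ in a..x, E.e11 x y θ *ᵥ u1 θ) + (∫ θ in x..b, E.e12 x y θ *ᵥ u1 θ)
  + E.e20 x y *ᵥ u2 y
  + (∫ ν in c..y, E.e21 x y ν *ᵥ u2 ν) + (∫ ν in y..d, E.e22 x y ν *ᵥ u2 ν)


/-! ### Parametric integrals of continuous functions -/

section Integrals

variable {Z : Type*} [TopologicalSpace Z] {V : Type*} [NormedAddCommGroup V] [NormedSpace ℝ V]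

lemma continuous_intervalIntegral_param {f : Z → ℝ → V} {s t : Z → ℝ}
    (hf : Continuous f.uncurry) (hs : Continuous s) (ht : Continuous t) :
    Continuous fun z => ∫ θ in s z..t z, f z θ := by
  have hint : ∀ z p q, IntervalIntegrable (f z) volume p q := fun z p q =>
    (hf.comp (by fun_prop : Continuous fun θ : ℝ => (z, θ))).intervalIntegrable p q
  have h : (fun z => ∫ θ in s z..t z, f z θ)
      = fun z => (∫ θ in (0 : ℝ)..t z, f z θ) - ∫ θ in (0 : ℝ)..s z, f z θ := by
    funext z
    rw [intervalIntegral.integral_interval_sub_left (hint _ _ _) (hint _ _ _)]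
  rw [h]
  exact (intervalIntegral.continuous_parametric_intervalIntegral_of_continuous hf ht).sub
    (intervalIntegral.continuous_parametric_intervalIntegral_of_continuous hf hs)

lemma integrableOn_uIoc_prod_uIoc {W : Type*} [NormedAddCommGroup W] {G : ℝ → ℝ → W}
    (hG : Continuous G.uncurry) (p q r s : ℝ) :
    IntegrableOn G.uncurry (uIoc p q ×ˢ uIoc r s) :=
  (hG.continuousOn.integrableOn_compact (isCompact_Icc.prod isCompact_Icc)).mono_set
    (Set.prod_mono Ioc_subset_Icc_self Ioc_subset_Icc_self)

lemma intervalIntegral_swap_of_continuous {G : ℝ → ℝ → V} (hG : Continuous G.uncurry)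
    (p q r s : ℝ) :
    ∫ θ in p..q, ∫ η in r..s, G θ η = ∫ η in r..s, ∫ θ in p..q, G θ η :=
  intervalIntegral_intervalIntegral_swap (integrableOn_uIoc_prod_uIoc hG p q r s)

lemma intervalIntegral_triangle_swap_of_le {G : ℝ → ℝ → V} (hG : Continuous G.uncurry)
    {p s : ℝ} (hps : p ≤ s) :
    ∫ θ in p..s, ∫ η in p..θ, G θ η = ∫ η in p..s, ∫ θ in η..s, G θ η := by
  set F : ℝ → ℝ → V := fun θ η => {q : ℝ × ℝ | q.2 ≤ q.1}.indicator G.uncurry (θ, η) with hF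
  have hswap : ∫ θ in p..s, ∫ η in p..s, F θ η = ∫ η in p..s, ∫ θ in p..s, F θ η := by
    refine intervalIntegral_intervalIntegral_swap ?_
    have hm : MeasurableSet {q : ℝ × ℝ | q.2 ≤ q.1} :=
      measurableSet_le measurable_snd measurable_fst
    exact (integrableOn_uIoc_prod_uIoc hG p s p s).indicator hm
  have hl : ∫ θ in p..s, ∫ η in p..s, F θ η = ∫ θ in p..s, ∫ η in p..θ, G θ η := by
    refine intervalIntegral.integral_congr fun θ hθ => ?_
    rw [uIcc_of_le hps] at hθ
    exact intervalIntegral.integral_indicator (f := G θ) hθ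
  have hr : ∫ η in p..s, ∫ θ in p..s, F θ η = ∫ η in p..s, ∫ θ in η..s, G θ η := by
    rw [intervalIntegral.integral_of_le hps, intervalIntegral.integral_of_le hps]
    refine setIntegral_congr_fun measurableSet_Ioc fun η hη => ?_
    have hset : Ioc p s ∩ Ici η = Icc η s := by
      ext θ
      simp only [mem_inter_iff, mem_Ioc, mem_Ici, mem_Icc]
      exact ⟨fun h => ⟨h.2, h.1.2⟩, fun h => ⟨⟨hη.1.trans_le h.1, h.2⟩, h.1⟩⟩
    have hi : (fun θ => F θ η) = (Ici η).indicator fun θ => G θ η := by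
      funext θ
      simp [hF, Set.indicator_apply, Function.uncurry]
    rw [intervalIntegral.integral_of_le hps, intervalIntegral.integral_of_le hη.2, hi,
      setIntegral_indicator measurableSet_Ici, hset, integral_Icc_eq_integral_Ioc]
  rw [← hl, hswap, hr]

lemma intervalIntegral_triangle_swap {G : ℝ → ℝ → V} (hG : Continuous G.uncurry) (p s : ℝ) :
    ∫ θ in p..s, ∫ η in p..θ, G θ η = ∫ η in p..s, ∫ θ in η..s, G θ η := by
  rcases le_total p s with h | h
  · exact intervalIntegral_triangle_swap_of_le hG h
  · have hG' : Continuous (fun η θ => G θ η).uncurry := hG.comp continuous_swap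
    have := intervalIntegral_triangle_swap_of_le hG' h
    rw [intervalIntegral.integral_symm s p, intervalIntegral.integral_symm s p]
    simp_rw [fun θ => intervalIntegral.integral_symm (μ := volume) (f := G θ) θ p,
      fun η => intervalIntegral.integral_symm (μ := volume) (f := fun θ => G θ η) s η,
      intervalIntegral.integral_neg, this]

end Integrals

section MatrixIntegrals

variable {Z : Type*} [TopologicalSpace Z] {p r : ℕ}

lemma continuous_mInt {K : Z → ℝ → Matrix (Fin p) (Fin r) ℝ} {s t : Z → ℝ}
    (hK : Continuous K.uncurry) (hs : Continuous s) (ht : Continuous t) :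
    Continuous fun z => mInt (s z) (t z) (K z) :=
  continuous_matrix fun i j =>
    continuous_intervalIntegral_param (f := fun z θ => K z θ i j) (hK.matrix_elem i j) hs ht

lemma mInt_mulVec {K : ℝ → Matrix (Fin p) (Fin r) ℝ} (hK : Continuous K) (s t : ℝ)
    (w : Fin r → ℝ) : mInt s t K *ᵥ w = ∫ θ in s..t, K θ *ᵥ w := by
  have hKw : Continuous fun θ => K θ *ᵥ w := hK.matrix_mulVec continuous_const
  funext i
  have h := (ContinuousLinearMap.proj (R := ℝ) (φ := fun _ : Fin p => ℝ) i).intervalIntegral_comp_comm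
    (hKw.intervalIntegrable (μ := volume) s t)
  simp only [ContinuousLinearMap.proj_apply] at h
  rw [← h]
  have hsum := intervalIntegral.integral_finsetSum (μ := volume) (a := s) (b := t)
    (s := Finset.univ) (f := fun j θ => K θ i j * w j) fun j _ =>
      ((hK.matrix_elem i j).mul continuous_const).intervalIntegrable _ _
  simp_rw [intervalIntegral.integral_mul_const] at hsum
  exact hsum.symm

lemma mulVec_intervalIntegral (A : Matrix (Fin p) (Fin r) ℝ) {f : ℝ → Fin r → ℝ}
    (hf : Continuous f) (s t : ℝ) : A *ᵥ (∫ θ in s..t, f θ) = ∫ θ in s..t, A *ᵥ f θ :=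
  ((LinearMap.toContinuousLinearMap A.mulVecLin).intervalIntegral_comp_comm
    (hf.intervalIntegrable s t)).symm

end MatrixIntegrals

/-! ### One-variable PI operators depending on a parameter -/

section ParametricPI

variable {Z Y : Type*} [TopologicalSpace Z] [TopologicalSpace Y] {p q r : ℕ} {α β : ℝ}

/-- `R` maps `u` to a multiplier, a Volterra and a Fredholm integral of `u` on `[α, β]`, with
kernels depending continuously on a parameter `z`, evaluated at the position `ξ z`. -/
def IsParamPI (α β : ℝ) (ξ : Z → ℝ) (R : (ℝ → Fin r → ℝ) → Z → Fin p → ℝ) : Prop :=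
  ∃ (k0 : Z → Matrix (Fin p) (Fin r) ℝ) (k1 k2 : Z → ℝ → Matrix (Fin p) (Fin r) ℝ),
    Continuous k0 ∧ Continuous k1.uncurry ∧ Continuous k2.uncurry ∧
    ∀ u, Continuous u → ∀ z, R u z = k0 z *ᵥ u (ξ z)
      + (∫ η in α..ξ z, k1 z η *ᵥ u η) + ∫ η in α..β, k2 z η *ᵥ u η

namespace IsParamPI

variable {ξ : Z → ℝ} {R S : (ℝ → Fin r → ℝ) → Z → Fin p → ℝ}

lemma continuous (hR : IsParamPI α β ξ R) (hξ : Continuous ξ) {u : ℝ → Fin r → ℝ}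
    (hu : Continuous u) : Continuous (R u) := by
  obtain ⟨k0, k1, k2, h0, h1, h2, h⟩ := hR
  rw [funext (h u hu)]
  exact ((h0.matrix_mulVec (hu.comp hξ)).add
    (continuous_intervalIntegral_param (f := fun z η => k1 z η *ᵥ u η)
      (h1.matrix_mulVec (hu.comp continuous_snd)) continuous_const hξ)).add
    (continuous_intervalIntegral_param (f := fun z η => k2 z η *ᵥ u η)
      (h2.matrix_mulVec (hu.comp continuous_snd)) continuous_const continuous_const)

lemma comp (hR : IsParamPI α β ξ R) {g : Y → Z} (hg : Continuous g) :
    IsParamPI α β (fun y => ξ (g y)) fun u y => R u (g y) := by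
  obtain ⟨k0, k1, k2, h0, h1, h2, h⟩ := hR
  exact ⟨fun y => k0 (g y), fun y => k1 (g y), fun y => k2 (g y), h0.comp hg,
    h1.comp (hg.prodMap continuous_id), h2.comp (hg.prodMap continuous_id),
    fun u hu y => h u hu (g y)⟩

lemma mulVec (hR : IsParamPI α β ξ R) {K : Z → Matrix (Fin q) (Fin p) ℝ} (hK : Continuous K) :
    IsParamPI α β ξ fun u z => K z *ᵥ R u z := by
  obtain ⟨k0, k1, k2, h0, h1, h2, h⟩ := hR
  refine ⟨fun z => K z * k0 z, fun z η => K z * k1 z η, fun z η => K z * k2 z η,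
    hK.matrix_mul h0, (hK.comp continuous_fst).matrix_mul h1,
    (hK.comp continuous_fst).matrix_mul h2, fun u hu z => ?_⟩
  have hk : ∀ k : Z → ℝ → Matrix (Fin p) (Fin r) ℝ, Continuous k.uncurry →
      Continuous fun η => k z η *ᵥ u η := fun k hk =>
    (hk.comp (by fun_prop : Continuous fun η : ℝ => (z, η))).matrix_mulVec hu
  simp only [h u hu z, mulVec_add, ← mulVec_mulVec, mulVec_intervalIntegral (K z) (hk k1 h1),
    mulVec_intervalIntegral (K z) (hk k2 h2)]

lemma neg (hR : IsParamPI α β ξ R) : IsParamPI α β ξ fun u z => -R u z := by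
  simpa [neg_mulVec] using hR.mulVec (K := fun _ => (-1 : Matrix (Fin p) (Fin p) ℝ)) continuous_const

lemma add (hR : IsParamPI α β ξ R) (hS : IsParamPI α β ξ S) :
    IsParamPI α β ξ fun u z => R u z + S u z := by
  obtain ⟨k0, k1, k2, h0, h1, h2, h⟩ := hR
  obtain ⟨l0, l1, l2, g0, g1, g2, g⟩ := hS
  refine ⟨fun z => k0 z + l0 z, fun z η => k1 z η + l1 z η, fun z η => k2 z η + l2 z η,
    h0.add g0, h1.add g1, h2.add g2, fun u hu z => ?_⟩
  have hk : ∀ k : Z → ℝ → Matrix (Fin p) (Fin r) ℝ, Continuous k.uncurry → ∀ s t : ℝ,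
      IntervalIntegrable (fun η => k z η *ᵥ u η) volume s t := fun k hk s t =>
    ((hk.comp (by fun_prop : Continuous fun η : ℝ => (z, η))).matrix_mulVec hu).intervalIntegrable
      s t
  simp only [h u hu z, g u hu z, add_mulVec]
  rw [intervalIntegral.integral_add (hk k1 h1 _ _) (hk l1 g1 _ _),
    intervalIntegral.integral_add (hk k2 h2 _ _) (hk l2 g2 _ _)]
  abel

lemma of_integrals {k1 k2 : Z → ℝ → Matrix (Fin p) (Fin r) ℝ} (h1 : Continuous k1.uncurry)
    (h2 : Continuous k2.uncurry)
    (h : ∀ u, Continuous u → ∀ z, R u z =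
      (∫ η in α..ξ z, k1 z η *ᵥ u η) + ∫ η in α..β, k2 z η *ᵥ u η) : IsParamPI α β ξ R :=
  ⟨fun _ => 0, k1, k2, continuous_const, h1, h2, fun u hu z => by simp [h u hu z]⟩

lemma mulVec_eval {K : Z → Matrix (Fin p) (Fin r) ℝ} (hK : Continuous K) :
    IsParamPI α β ξ fun u z => K z *ᵥ u (ξ z) :=
  ⟨K, fun _ _ => 0, fun _ _ => 0, hK, continuous_const, continuous_const,
    fun u _ z => by simp⟩

/-- Integrating in a variable on which the position does not depend. -/
lemma integral_of_fst {R : (ℝ → Fin r → ℝ) → Z × ℝ → Fin p → ℝ}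
    (hR : IsParamPI α β (fun w => ξ w.1) R) {s t : Z → ℝ} (hs : Continuous s)
    (ht : Continuous t) :
    IsParamPI α β ξ fun u z => ∫ θ in s z..t z, R u (z, θ) := by
  obtain ⟨k0, k1, k2, h0, h1, h2, h⟩ := hR
  have hc : ∀ k : Z × ℝ → ℝ → Matrix (Fin p) (Fin r) ℝ, Continuous k.uncurry →
      Continuous (fun z η => mInt (s z) (t z) fun θ => k (z, θ) η).uncurry := fun k hk =>
    continuous_mInt (Z := Z × ℝ) (K := fun w θ => k (w.1, θ) w.2)
      (hk.comp (by fun_prop : Continuous fun w : (Z × ℝ) × ℝ => ((w.1.1, w.2), w.1.2)))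
      (hs.comp continuous_fst) (ht.comp continuous_fst)
  refine ⟨fun z => mInt (s z) (t z) fun θ => k0 (z, θ), _, _,
    continuous_mInt (K := fun z θ => k0 (z, θ)) h0 hs ht, hc k1 h1, hc k2 h2,
    fun u hu z => ?_⟩
  have hjoint : ∀ k : Z × ℝ → ℝ → Matrix (Fin p) (Fin r) ℝ, Continuous k.uncurry →
      Continuous (fun θ η => k (z, θ) η *ᵥ u η).uncurry := fun k hk =>
    (hk.comp (by fun_prop : Continuous fun w : ℝ × ℝ => ((z, w.1), w.2))).matrix_mulVec
      (hu.comp continuous_snd)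
  have hint : ∀ k : Z × ℝ → ℝ → Matrix (Fin p) (Fin r) ℝ, Continuous k.uncurry → ∀ x y : ℝ,
      IntervalIntegrable (fun θ => ∫ η in x..y, k (z, θ) η *ᵥ u η) volume (s z) (t z) :=
    fun k hk x y => (continuous_intervalIntegral_param (hjoint k hk) continuous_const
      continuous_const).intervalIntegrable _ _
  have hm : ∀ k : Z × ℝ → ℝ → Matrix (Fin p) (Fin r) ℝ, Continuous k.uncurry → ∀ x y : ℝ,
      ∫ θ in s z..t z, ∫ η in x..y, k (z, θ) η *ᵥ u η
        = ∫ η in x..y, (mInt (s z) (t z) fun θ => k (z, θ) η) *ᵥ u η := fun k hk x y => by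
    rw [intervalIntegral_swap_of_continuous (hjoint k hk)]
    congr 1
    funext η
    exact (mInt_mulVec
      (hk.comp (by fun_prop : Continuous fun θ : ℝ => ((z, θ), η))) _ _ _).symm
  have hk0 : Continuous fun θ => k0 (z, θ) := h0.comp (by fun_prop)
  have hi0 : IntervalIntegrable (fun θ => k0 (z, θ) *ᵥ u (ξ z)) volume (s z) (t z) :=
    (hk0.matrix_mulVec continuous_const).intervalIntegrable _ _
  simp only [h u hu]
  rw [intervalIntegral.integral_add (hi0.add (hint k1 h1 _ _)) (hint k2 h2 _ _),
    intervalIntegral.integral_add hi0 (hint k1 h1 _ _), hm k1 h1, hm k2 h2,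
    mInt_mulVec hk0]

/-- Integrating in the position variable gives a Volterra part up to the end point of
integration, plus a Fredholm part. -/
lemma exists_integral_snd_eq {R : (ℝ → Fin r → ℝ) → Z × ℝ → Fin p → ℝ}
    (hR : IsParamPI α β Prod.snd R) {s : Z → ℝ} (hs : Continuous s) :
    ∃ l1 l2 : Z → ℝ → Matrix (Fin p) (Fin r) ℝ, Continuous l1.uncurry ∧ Continuous l2.uncurry ∧
      ∀ u, Continuous u → ∀ z, ∫ θ in α..s z, R u (z, θ)
        = (∫ η in α..s z, l1 z η *ᵥ u η) + ∫ η in α..β, l2 z η *ᵥ u η := by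
  obtain ⟨k0, k1, k2, h0, h1, h2, h⟩ := hR
  have hK : ∀ k : Z × ℝ → ℝ → Matrix (Fin p) (Fin r) ℝ, Continuous k.uncurry →
      Continuous fun w : (Z × ℝ) × ℝ => k (w.1.1, w.2) w.1.2 := fun k hk =>
    hk.comp (by fun_prop : Continuous fun w : (Z × ℝ) × ℝ => ((w.1.1, w.2), w.1.2))
  have hl1 : Continuous fun w : Z × ℝ => mInt w.2 (s w.1) fun θ => k1 (w.1, θ) w.2 :=
    continuous_mInt (Z := Z × ℝ) (K := fun w θ => k1 (w.1, θ) w.2) (hK k1 h1) continuous_snd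
      (hs.comp continuous_fst)
  have hl2 : Continuous fun w : Z × ℝ => mInt α (s w.1) fun θ => k2 (w.1, θ) w.2 :=
    continuous_mInt (Z := Z × ℝ) (K := fun w θ => k2 (w.1, θ) w.2) (hK k2 h2) continuous_const
      (hs.comp continuous_fst)
  refine ⟨fun z η => k0 (z, η) + mInt η (s z) fun θ => k1 (z, θ) η,
    fun z η => mInt α (s z) fun θ => k2 (z, θ) η, h0.add hl1, hl2, fun u hu z => ?_⟩
  have hjoint : ∀ k : Z × ℝ → ℝ → Matrix (Fin p) (Fin r) ℝ, Continuous k.uncurry →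
      Continuous (fun θ η => k (z, θ) η *ᵥ u η).uncurry := fun k hk =>
    (hk.comp (by fun_prop : Continuous fun w : ℝ × ℝ => ((z, w.1), w.2))).matrix_mulVec
      (hu.comp continuous_snd)
  have hm : ∀ k : Z × ℝ → ℝ → Matrix (Fin p) (Fin r) ℝ, Continuous k.uncurry → ∀ x y η : ℝ,
      (mInt x y fun θ => k (z, θ) η) *ᵥ u η = ∫ θ in x..y, k (z, θ) η *ᵥ u η :=
    fun k hk x y η => mInt_mulVec
      (hk.comp (by fun_prop : Continuous fun θ : ℝ => ((z, θ), η))) _ _ _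
  have hi0 : IntervalIntegrable (fun θ => k0 (z, θ) *ᵥ u θ) volume α (s z) :=
    ((h0.comp (by fun_prop : Continuous fun θ : ℝ => (z, θ))).matrix_mulVec hu).intervalIntegrable
      _ _
  have hi1 : IntervalIntegrable (fun θ => ∫ η in α..θ, k1 (z, θ) η *ᵥ u η) volume α (s z) :=
    (continuous_intervalIntegral_param (hjoint k1 h1) continuous_const
      continuous_id).intervalIntegrable _ _
  have hi2 : IntervalIntegrable (fun θ => ∫ η in α..β, k2 (z, θ) η *ᵥ u η) volume α (s z) :=
    (continuous_intervalIntegral_param (hjoint k2 h2) continuous_const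
      continuous_const).intervalIntegrable _ _
  have hi3 : IntervalIntegrable (fun η => ∫ θ in η..s z, k1 (z, θ) η *ᵥ u η) volume α (s z) :=
    (continuous_intervalIntegral_param (f := fun η θ => k1 (z, θ) η *ᵥ u η)
      ((hjoint k1 h1).comp continuous_swap) continuous_id continuous_const).intervalIntegrable _ _
  simp only [h u hu, add_mulVec, hm k1 h1, hm k2 h2]
  rw [intervalIntegral.integral_add (hi0.add hi1) hi2, intervalIntegral.integral_add hi0 hi1,
    intervalIntegral.integral_add hi0 hi3, intervalIntegral_triangle_swap (hjoint k1 h1),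
    intervalIntegral_swap_of_continuous (hjoint k2 h2)]

variable {R : (ℝ → Fin r → ℝ) → Z × ℝ → Fin p → ℝ}

lemma integral_lower (hR : IsParamPI α β Prod.snd R) (hξ : Continuous ξ) :
    IsParamPI α β ξ fun u z => ∫ θ in α..ξ z, R u (z, θ) := by
  obtain ⟨l1, l2, h1, h2, h⟩ := hR.exists_integral_snd_eq hξ
  exact of_integrals h1 h2 h

lemma integral_full (hR : IsParamPI α β Prod.snd R) :
    IsParamPI α β ξ fun u z => ∫ θ in α..β, R u (z, θ) := by
  obtain ⟨l1, l2, h1, h2, h⟩ := hR.exists_integral_snd_eq (s := fun _ => β) continuous_const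
  refine of_integrals (k1 := fun _ _ => 0) (k2 := fun z η => l1 z η + l2 z η) continuous_const
    (h1.add h2) fun u hu z => ?_
  have hi : ∀ l : Z → ℝ → Matrix (Fin p) (Fin r) ℝ, Continuous l.uncurry →
      IntervalIntegrable (fun η => l z η *ᵥ u η) volume α β := fun l hl =>
    ((hl.comp (by fun_prop : Continuous fun η : ℝ => (z, η))).matrix_mulVec hu).intervalIntegrable
      _ _
  simp only [h u hu z, add_mulVec, zero_mulVec, intervalIntegral.integral_zero, zero_add]
  rw [intervalIntegral.integral_add (hi l1 h1) (hi l2 h2)]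

lemma congr {R S : (ℝ → Fin r → ℝ) → Z → Fin p → ℝ} (hR : IsParamPI α β ξ R)
    (h : ∀ u, Continuous u → ∀ z, S u z = R u z) : IsParamPI α β ξ S := by
  obtain ⟨k0, k1, k2, h0, h1, h2, hk⟩ := hR
  exact ⟨k0, k1, k2, h0, h1, h2, fun u hu z => (h u hu z).trans (hk u hu z)⟩

lemma integral_upper (hR : IsParamPI α β Prod.snd R) (hξ : Continuous ξ) :
    IsParamPI α β ξ fun u z => ∫ θ in ξ z..β, R u (z, θ) := by
  refine (hR.integral_full.add (hR.integral_lower hξ).neg).congr fun u hu z => ?_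
  have hi : ∀ x y : ℝ, IntervalIntegrable (fun θ => R u (z, θ)) volume x y := fun x y =>
    ((hR.continuous continuous_snd hu).comp (by fun_prop)).intervalIntegrable x y
  rw [← sub_eq_add_neg, intervalIntegral.integral_interval_sub_left (hi _ _) (hi _ _)]

end IsParamPI

end ParametricPI

/-! ### Two-variable PI operators depending on a parameter -/

section ParametricPI011

variable {Z Y : Type*} [TopologicalSpace Z] [TopologicalSpace Y] {p q r0 r1 : ℕ}
  {a b c d : ℝ}

/-- `L` is the sum of a multiplier acting on the vector and of parametric one-variable PI
operators acting on the two functions, at the positions `ξ z` and `ψ z`. -/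
def IsParamPI011 (a b c d : ℝ) (ξ ψ : Z → ℝ)
    (L : (Fin r0 → ℝ) → (ℝ → Fin r1 → ℝ) → (ℝ → Fin r1 → ℝ) → Z → Fin p → ℝ) : Prop :=
  ∃ (E : Z → Matrix (Fin p) (Fin r0) ℝ) (R S : (ℝ → Fin r1 → ℝ) → Z → Fin p → ℝ),
    Continuous E ∧ IsParamPI a b ξ R ∧ IsParamPI c d ψ S ∧
    ∀ v u1 u2, Continuous u1 → Continuous u2 → ∀ z, L v u1 u2 z = E z *ᵥ v + R u1 z + S u2 z

namespace IsParamPI011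

section

variable {ξ ψ : Z → ℝ}
  {L M : (Fin r0 → ℝ) → (ℝ → Fin r1 → ℝ) → (ℝ → Fin r1 → ℝ) → Z → Fin p → ℝ}

lemma comp (hL : IsParamPI011 a b c d ξ ψ L) {g : Y → Z} (hg : Continuous g) :
    IsParamPI011 a b c d (fun y => ξ (g y)) (fun y => ψ (g y))
      fun v u1 u2 y => L v u1 u2 (g y) := by
  obtain ⟨E, R, S, hE, hR, hS, h⟩ := hL
  exact ⟨_, _, _, hE.comp hg, hR.comp hg, hS.comp hg,
    fun v u1 u2 hu1 hu2 y => h v u1 u2 hu1 hu2 (g y)⟩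

lemma mulVec (hL : IsParamPI011 a b c d ξ ψ L) {K : Z → Matrix (Fin q) (Fin p) ℝ}
    (hK : Continuous K) :
    IsParamPI011 a b c d ξ ψ fun v u1 u2 z => K z *ᵥ L v u1 u2 z := by
  obtain ⟨E, R, S, hE, hR, hS, h⟩ := hL
  refine ⟨_, _, _, hK.matrix_mul hE, hR.mulVec hK, hS.mulVec hK,
    fun v u1 u2 hu1 hu2 z => ?_⟩
  simp only [h v u1 u2 hu1 hu2 z, mulVec_add, mulVec_mulVec]

lemma add (hL : IsParamPI011 a b c d ξ ψ L) (hM : IsParamPI011 a b c d ξ ψ M) :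
    IsParamPI011 a b c d ξ ψ fun v u1 u2 z => L v u1 u2 z + M v u1 u2 z := by
  obtain ⟨E, R, S, hE, hR, hS, h⟩ := hL
  obtain ⟨F, P, Q, hF, hP, hQ, k⟩ := hM
  refine ⟨fun z => E z + F z, _, _, hE.add hF, hR.add hP, hS.add hQ,
    fun v u1 u2 hu1 hu2 z => ?_⟩
  simp only [h v u1 u2 hu1 hu2 z, k v u1 u2 hu1 hu2 z, add_mulVec]
  abel

end

variable {ξ ψ s t : Z → ℝ}
  {L : (Fin r0 → ℝ) → (ℝ → Fin r1 → ℝ) → (ℝ → Fin r1 → ℝ) → Z × ℝ → Fin p → ℝ}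

lemma integral {ξ' ψ' : Z × ℝ → ℝ} (hL : IsParamPI011 a b c d ξ' ψ' L)
    (hξ' : Continuous ξ') (hψ' : Continuous ψ') (hs : Continuous s) (ht : Continuous t)
    (hx : ∀ {R : (ℝ → Fin r1 → ℝ) → Z × ℝ → Fin p → ℝ}, IsParamPI a b ξ' R →
      IsParamPI a b ξ fun u z => ∫ θ in s z..t z, R u (z, θ))
    (hy : ∀ {R : (ℝ → Fin r1 → ℝ) → Z × ℝ → Fin p → ℝ}, IsParamPI c d ψ' R →
      IsParamPI c d ψ fun u z => ∫ θ in s z..t z, R u (z, θ)) :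
    IsParamPI011 a b c d ξ ψ fun v u1 u2 z => ∫ θ in s z..t z, L v u1 u2 (z, θ) := by
  obtain ⟨E, R, S, hE, hR, hS, h⟩ := hL
  refine ⟨fun z => mInt (s z) (t z) fun θ => E (z, θ), _, _,
    continuous_mInt (K := fun z θ => E (z, θ)) hE hs ht, hx hR, hy hS,
    fun v u1 u2 hu1 hu2 z => ?_⟩
  have hz : Continuous fun θ : ℝ => (z, θ) := by fun_prop
  have iE : IntervalIntegrable (fun θ => E (z, θ) *ᵥ v) volume (s z) (t z) :=
    ((hE.comp hz).matrix_mulVec continuous_const).intervalIntegrable _ _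
  have iR : IntervalIntegrable (fun θ => R u1 (z, θ)) volume (s z) (t z) :=
    ((hR.continuous hξ' hu1).comp hz).intervalIntegrable _ _
  have iS : IntervalIntegrable (fun θ => S u2 (z, θ)) volume (s z) (t z) :=
    ((hS.continuous hψ' hu2).comp hz).intervalIntegrable _ _
  simp only [h v u1 u2 hu1 hu2]
  rw [intervalIntegral.integral_add (iE.add iR) iS, intervalIntegral.integral_add iE iR,
    mInt_mulVec (K := fun θ => E (z, θ)) (hE.comp hz)]

lemma integral_x_lower (hL : IsParamPI011 a b c d Prod.snd (fun w => ψ w.1) L)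
    (hξ : Continuous ξ) (hψ : Continuous ψ) :
    IsParamPI011 a b c d ξ ψ fun v u1 u2 z => ∫ θ in a..ξ z, L v u1 u2 (z, θ) :=
  hL.integral continuous_snd (hψ.comp continuous_fst) continuous_const hξ
    (fun h => h.integral_lower hξ) fun h => h.integral_of_fst continuous_const hξ

lemma integral_x_upper (hL : IsParamPI011 a b c d Prod.snd (fun w => ψ w.1) L)
    (hξ : Continuous ξ) (hψ : Continuous ψ) :
    IsParamPI011 a b c d ξ ψ fun v u1 u2 z => ∫ θ in ξ z..b, L v u1 u2 (z, θ) :=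
  hL.integral continuous_snd (hψ.comp continuous_fst) hξ continuous_const
    (fun h => h.integral_upper hξ) fun h => h.integral_of_fst hξ continuous_const

lemma integral_y_lower (hL : IsParamPI011 a b c d (fun w => ξ w.1) Prod.snd L)
    (hξ : Continuous ξ) (hψ : Continuous ψ) :
    IsParamPI011 a b c d ξ ψ fun v u1 u2 z => ∫ θ in c..ψ z, L v u1 u2 (z, θ) :=
  hL.integral (hξ.comp continuous_fst) continuous_snd continuous_const hψ
    (fun h => h.integral_of_fst continuous_const hψ) fun h => h.integral_lower hψ

lemma integral_y_upper (hL : IsParamPI011 a b c d (fun w => ξ w.1) Prod.snd L)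
    (hξ : Continuous ξ) (hψ : Continuous ψ) :
    IsParamPI011 a b c d ξ ψ fun v u1 u2 z => ∫ θ in ψ z..d, L v u1 u2 (z, θ) :=
  hL.integral (hξ.comp continuous_fst) continuous_snd hψ continuous_const
    (fun h => h.integral_of_fst hψ continuous_const) fun h => h.integral_upper hψ

lemma exists_kernels
    {L : (Fin r0 → ℝ) → (ℝ → Fin r1 → ℝ) → (ℝ → Fin r1 → ℝ) → ℝ × ℝ → Fin p → ℝ}
    (hL : IsParamPI011 a b c d Prod.fst Prod.snd L) :
    ∃ T : PI011to2DK p r0 r1, T.IsCont a b c d ∧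
      ∀ v u1 u2, Continuous u1 → Continuous u2 → ∀ x y,
        L v u1 u2 (x, y) = PI011to2D a b c d T v u1 u2 x y := by
  obtain ⟨E, R, S, hE, ⟨k0, k1, k2, h0, h1, h2, hR⟩, ⟨l0, l1, l2, g0, g1, g2, hS⟩, h⟩ := hL
  have hcont : ∀ k : ℝ × ℝ → ℝ → Matrix (Fin p) (Fin r1) ℝ, Continuous k.uncurry →
      Continuous fun w : ℝ × ℝ × ℝ => k (w.1, w.2.1) w.2.2 := fun k hk =>
    hk.comp (by fun_prop : Continuous fun w : ℝ × ℝ × ℝ => ((w.1, w.2.1), w.2.2))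
  refine ⟨⟨fun x y => E (x, y), fun x y => k0 (x, y),
    fun x y θ => k1 (x, y) θ + k2 (x, y) θ, fun x y θ => k2 (x, y) θ, fun x y => l0 (x, y),
    fun x y ν => l1 (x, y) ν + l2 (x, y) ν, fun x y ν => l2 (x, y) ν⟩,
    ⟨hE.continuousOn, h0.continuousOn, ((hcont k1 h1).add (hcont k2 h2)).continuousOn,
      (hcont k2 h2).continuousOn, g0.continuousOn,
      ((hcont l1 g1).add (hcont l2 g2)).continuousOn, (hcont l2 g2).continuousOn⟩, ?_⟩
  intro v u1 u2 hu1 hu2 x y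
  have hi : ∀ k : ℝ × ℝ → ℝ → Matrix (Fin p) (Fin r1) ℝ, Continuous k.uncurry →
      ∀ u : ℝ → Fin r1 → ℝ, Continuous u → ∀ s t : ℝ,
      IntervalIntegrable (fun η => k (x, y) η *ᵥ u η) volume s t := fun k hk u hu s t =>
    ((hk.comp (by fun_prop : Continuous fun η : ℝ => ((x, y), η))).matrix_mulVec
      hu).intervalIntegrable s t
  simp only [PI011to2D, h v u1 u2 hu1 hu2, hR u1 hu1, hS u2 hu2, add_mulVec]
  rw [intervalIntegral.integral_add (hi k1 h1 u1 hu1 _ _) (hi k2 h2 u1 hu1 _ _),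
    intervalIntegral.integral_add (hi l1 g1 u2 hu2 _ _) (hi l2 g2 u2 hu2 _ _),
    ← intervalIntegral.integral_add_adjacent_intervals (hi k2 h2 u1 hu1 a x) (hi k2 h2 u1 hu1 x b),
    ← intervalIntegral.integral_add_adjacent_intervals (hi l2 g2 u2 hu2 c y) (hi l2 g2 u2 hu2 y d)]
  abel

end IsParamPI011

end ParametricPI011

/-! ### Extending kernels from the rectangle to the plane -/

section Clamp

variable {p r r0 r1 : ℕ} {a b c d s t x y : ℝ}

/-- The retraction of the real line onto `[s, t]`. -/
def clampIcc (s t x : ℝ) : ℝ := max s (min t x)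

@[fun_prop]
lemma continuous_clampIcc : Continuous (clampIcc s t) := by
  unfold clampIcc
  fun_prop

lemma clampIcc_mem (h : s ≤ t) (x : ℝ) : clampIcc s t x ∈ Icc s t :=
  ⟨le_max_left _ _, max_le h (min_le_left _ _)⟩

lemma clampIcc_of_mem (hx : x ∈ Icc s t) : clampIcc s t x = x := by
  simp [clampIcc, hx.1, hx.2]

lemma intervalIntegral_congr_Icc {V : Type*} [NormedAddCommGroup V] [NormedSpace ℝ V]
    {f g : ℝ → V} (hx : x ∈ Icc s t) (hy : y ∈ Icc s t) (h : ∀ θ ∈ Icc s t, f θ = g θ) :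
    ∫ θ in x..y, f θ = ∫ θ in x..y, g θ :=
  intervalIntegral.integral_congr fun θ hθ => h θ (uIcc_subset_Icc hx hy hθ)

/-- Constant extension of the kernels outside of the rectangle. -/
def PI2DK.clamp (a b c d : ℝ) (N : PI2DK p r) : PI2DK p r where
  k00 x y := N.k00 (clampIcc a b x) (clampIcc c d y)
  k10 x y θ := N.k10 (clampIcc a b x) (clampIcc c d y) (clampIcc a b θ)
  k20 x y θ := N.k20 (clampIcc a b x) (clampIcc c d y) (clampIcc a b θ)
  k01 x y ν := N.k01 (clampIcc a b x) (clampIcc c d y) (clampIcc c d ν)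
  k02 x y ν := N.k02 (clampIcc a b x) (clampIcc c d y) (clampIcc c d ν)
  k11 x y θ ν := N.k11 (clampIcc a b x) (clampIcc c d y) (clampIcc a b θ) (clampIcc c d ν)
  k21 x y θ ν := N.k21 (clampIcc a b x) (clampIcc c d y) (clampIcc a b θ) (clampIcc c d ν)
  k12 x y θ ν := N.k12 (clampIcc a b x) (clampIcc c d y) (clampIcc a b θ) (clampIcc c d ν)
  k22 x y θ ν := N.k22 (clampIcc a b x) (clampIcc c d y) (clampIcc a b θ) (clampIcc c d ν)

/-- Constant extension of the kernels outside of the rectangle. -/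
def PI011to2DK.clamp (a b c d : ℝ) (E : PI011to2DK p r0 r1) : PI011to2DK p r0 r1 where
  e0 x y := E.e0 (clampIcc a b x) (clampIcc c d y)
  e10 x y := E.e10 (clampIcc a b x) (clampIcc c d y)
  e11 x y θ := E.e11 (clampIcc a b x) (clampIcc c d y) (clampIcc a b θ)
  e12 x y θ := E.e12 (clampIcc a b x) (clampIcc c d y) (clampIcc a b θ)
  e20 x y := E.e20 (clampIcc a b x) (clampIcc c d y)
  e21 x y ν := E.e21 (clampIcc a b x) (clampIcc c d y) (clampIcc c d ν)
  e22 x y ν := E.e22 (clampIcc a b x) (clampIcc c d y) (clampIcc c d ν)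

lemma PI2D_clamp_congr (N : PI2DK p r) {w w' : ℝ → ℝ → Fin r → ℝ} (hx : x ∈ Icc a b)
    (hy : y ∈ Icc c d) (hw : ∀ x ∈ Icc a b, ∀ y ∈ Icc c d, w x y = w' x y) :
    PI2D a b c d N w x y = PI2D a b c d (N.clamp a b c d) w' x y := by
  have ha : a ∈ Icc a b := left_mem_Icc.2 (hx.1.trans hx.2)
  have hb : b ∈ Icc a b := right_mem_Icc.2 (hx.1.trans hx.2)
  have hc : c ∈ Icc c d := left_mem_Icc.2 (hy.1.trans hy.2)
  have hd : d ∈ Icc c d := right_mem_Icc.2 (hy.1.trans hy.2)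
  simp only [PI2D, PI2DK.clamp, clampIcc_of_mem hx, clampIcc_of_mem hy, hw x hx y hy]
  congr! 1
  · congr! 1
    · congr! 1
      · congr! 1
        · congr! 1
          · congr! 1
            · congr! 1
              · congr! 1
                exact intervalIntegral_congr_Icc ha hx fun θ hθ => by
                  rw [clampIcc_of_mem hθ, hw θ hθ y hy]
              · exact intervalIntegral_congr_Icc hx hb fun θ hθ => by
                  rw [clampIcc_of_mem hθ, hw θ hθ y hy]
            · exact intervalIntegral_congr_Icc hc hy fun ν hν => by
                rw [clampIcc_of_mem hν, hw x hx ν hν]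
          · exact intervalIntegral_congr_Icc hy hd fun ν hν => by
              rw [clampIcc_of_mem hν, hw x hx ν hν]
        · exact intervalIntegral_congr_Icc ha hx fun θ hθ =>
            intervalIntegral_congr_Icc hc hy fun ν hν => by
              rw [clampIcc_of_mem hθ, clampIcc_of_mem hν, hw θ hθ ν hν]
      · exact intervalIntegral_congr_Icc hx hb fun θ hθ =>
          intervalIntegral_congr_Icc hc hy fun ν hν => by
            rw [clampIcc_of_mem hθ, clampIcc_of_mem hν, hw θ hθ ν hν]
    · exact intervalIntegral_congr_Icc ha hx fun θ hθ =>
        intervalIntegral_congr_Icc hy hd fun ν hν => by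
          rw [clampIcc_of_mem hθ, clampIcc_of_mem hν, hw θ hθ ν hν]
  · exact intervalIntegral_congr_Icc hx hb fun θ hθ =>
      intervalIntegral_congr_Icc hy hd fun ν hν => by
        rw [clampIcc_of_mem hθ, clampIcc_of_mem hν, hw θ hθ ν hν]

lemma PI011to2D_congr (E : PI011to2DK p r0 r1) (v : Fin r0 → ℝ)
    {u1 u1' u2 u2' : ℝ → Fin r1 → ℝ} (h1 : EqOn u1 u1' (Icc a b)) (h2 : EqOn u2 u2' (Icc c d))
    (hx : x ∈ Icc a b) (hy : y ∈ Icc c d) :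
    PI011to2D a b c d E v u1 u2 x y = PI011to2D a b c d E v u1' u2' x y := by
  have ha : a ∈ Icc a b := left_mem_Icc.2 (hx.1.trans hx.2)
  have hb : b ∈ Icc a b := right_mem_Icc.2 (hx.1.trans hx.2)
  have hc : c ∈ Icc c d := left_mem_Icc.2 (hy.1.trans hy.2)
  have hd : d ∈ Icc c d := right_mem_Icc.2 (hy.1.trans hy.2)
  simp only [PI011to2D, h1 hx, h2 hy]
  rw [intervalIntegral_congr_Icc ha hx fun θ hθ => by rw [h1 hθ],
    intervalIntegral_congr_Icc hx hb fun θ hθ => by rw [h1 hθ],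
    intervalIntegral_congr_Icc hc hy fun ν hν => by rw [h2 hν],
    intervalIntegral_congr_Icc hy hd fun ν hν => by rw [h2 hν]]

lemma PI011to2D_clamp (E : PI011to2DK p r0 r1) (v : Fin r0 → ℝ) (u1 u2 : ℝ → Fin r1 → ℝ)
    (hx : x ∈ Icc a b) (hy : y ∈ Icc c d) :
    PI011to2D a b c d (E.clamp a b c d) v u1 u2 x y = PI011to2D a b c d E v u1 u2 x y := by
  have ha : a ∈ Icc a b := left_mem_Icc.2 (hx.1.trans hx.2)
  have hb : b ∈ Icc a b := right_mem_Icc.2 (hx.1.trans hx.2)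
  have hc : c ∈ Icc c d := left_mem_Icc.2 (hy.1.trans hy.2)
  have hd : d ∈ Icc c d := right_mem_Icc.2 (hy.1.trans hy.2)
  simp only [PI011to2D, PI011to2DK.clamp, clampIcc_of_mem hx, clampIcc_of_mem hy]
  rw [intervalIntegral_congr_Icc ha hx fun θ hθ => by rw [clampIcc_of_mem hθ],
    intervalIntegral_congr_Icc hx hb fun θ hθ => by rw [clampIcc_of_mem hθ],
    intervalIntegral_congr_Icc hc hy fun ν hν => by rw [clampIcc_of_mem hν],
    intervalIntegral_congr_Icc hy hd fun ν hν => by rw [clampIcc_of_mem hν]]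

lemma isParamPI011_PI011to2D_clamp {E : PI011to2DK p r0 r1} (hE : E.IsCont a b c d)
    (hab : a ≤ b) (hcd : c ≤ d) :
    IsParamPI011 a b c d Prod.fst Prod.snd
      fun v u1 u2 (z : ℝ × ℝ) => PI011to2D a b c d (E.clamp a b c d) v u1 u2 z.1 z.2 := by
  obtain ⟨h0, h10, h11, h12, h20, h21, h22⟩ := hE
  have hx := clampIcc_mem hab
  have hy := clampIcc_mem hcd
  have hz : Continuous fun z : ℝ × ℝ => (clampIcc a b z.1, clampIcc c d z.2) := by fun_prop
  have hzx : Continuous fun w : (ℝ × ℝ) × ℝ =>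
      (clampIcc a b w.1.1, clampIcc c d w.1.2, clampIcc a b w.2) := by fun_prop
  have hzy : Continuous fun w : (ℝ × ℝ) × ℝ =>
      (clampIcc a b w.1.1, clampIcc c d w.1.2, clampIcc c d w.2) := by fun_prop
  have mz := fun z : ℝ × ℝ => mk_mem_prod (hx z.1) (hy z.2)
  have mx := fun w : (ℝ × ℝ) × ℝ => mk_mem_prod (hx w.1.1) (mk_mem_prod (hy w.1.2) (hx w.2))
  have my := fun w : (ℝ × ℝ) × ℝ => mk_mem_prod (hx w.1.1) (mk_mem_prod (hy w.1.2) (hy w.2))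
  refine ⟨_, _, _, h0.comp_continuous hz mz,
    ((IsParamPI.mulVec_eval (h10.comp_continuous hz mz)).add
      (IsParamPI.mulVec_eval (h11.comp_continuous hzx mx) |>.integral_lower continuous_fst)).add
      (IsParamPI.mulVec_eval (h12.comp_continuous hzx mx) |>.integral_upper continuous_fst),
    ((IsParamPI.mulVec_eval (h20.comp_continuous hz mz)).add
      (IsParamPI.mulVec_eval (h21.comp_continuous hzy my) |>.integral_lower continuous_snd)).add
      (IsParamPI.mulVec_eval (h22.comp_continuous hzy my) |>.integral_upper continuous_snd),
    fun v u1 u2 _ _ z => ?_⟩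
  simp only [PI011to2D, PI011to2DK.clamp]
  abel

lemma IsParamPI011.PI2D_clamp {q : ℕ} {N : PI2DK q p} (hN : N.IsCont a b c d)
    (hab : a ≤ b) (hcd : c ≤ d)
    {L : (Fin r0 → ℝ) → (ℝ → Fin r1 → ℝ) → (ℝ → Fin r1 → ℝ) → ℝ × ℝ → Fin p → ℝ}
    (hL : IsParamPI011 a b c d Prod.fst Prod.snd L) :
    IsParamPI011 a b c d Prod.fst Prod.snd fun v u1 u2 (z : ℝ × ℝ) =>
      PI2D a b c d (N.clamp a b c d) (fun x y => L v u1 u2 (x, y)) z.1 z.2 := by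
  obtain ⟨h00, h10, h20, h01, h02, h11, h21, h12, h22⟩ := hN
  have hx := clampIcc_mem hab
  have hy := clampIcc_mem hcd
  have hz : Continuous fun z : ℝ × ℝ => (clampIcc a b z.1, clampIcc c d z.2) := by fun_prop
  have hzx : Continuous fun w : (ℝ × ℝ) × ℝ =>
      (clampIcc a b w.1.1, clampIcc c d w.1.2, clampIcc a b w.2) := by fun_prop
  have hzy : Continuous fun w : (ℝ × ℝ) × ℝ =>
      (clampIcc a b w.1.1, clampIcc c d w.1.2, clampIcc c d w.2) := by fun_prop
  have hzxy : Continuous fun w : ((ℝ × ℝ) × ℝ) × ℝ => (clampIcc a b w.1.1.1,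
      clampIcc c d w.1.1.2, clampIcc a b w.1.2, clampIcc c d w.2) := by fun_prop
  have mz := fun z : ℝ × ℝ => mk_mem_prod (hx z.1) (hy z.2)
  have mx := fun w : (ℝ × ℝ) × ℝ => mk_mem_prod (hx w.1.1) (mk_mem_prod (hy w.1.2) (hx w.2))
  have my := fun w : (ℝ × ℝ) × ℝ => mk_mem_prod (hx w.1.1) (mk_mem_prod (hy w.1.2) (hy w.2))
  have mxy := fun w : ((ℝ × ℝ) × ℝ) × ℝ => mk_mem_prod (hx w.1.1.1)
    (mk_mem_prod (hy w.1.1.2) (mk_mem_prod (hx w.1.2) (hy w.2)))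
  have hLx := hL.comp (by fun_prop : Continuous fun w : (ℝ × ℝ) × ℝ => (w.2, w.1.2))
  have hLy := hL.comp (by fun_prop : Continuous fun w : (ℝ × ℝ) × ℝ => (w.1.1, w.2))
  have hLxy := hL.comp (by fun_prop : Continuous fun w : ((ℝ × ℝ) × ℝ) × ℝ => (w.1.2, w.2))
  have cf : Continuous fun z : ℝ × ℝ => z.1 := continuous_fst
  have cs : Continuous fun z : ℝ × ℝ => z.2 := continuous_snd
  have cw : Continuous fun w : (ℝ × ℝ) × ℝ => w.2 := continuous_snd
  have cy : Continuous fun w : (ℝ × ℝ) × ℝ => w.1.2 := by fun_prop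
  have t00 := hL.mulVec (h00.comp_continuous hz mz)
  have t10 := (hLx.mulVec (h10.comp_continuous hzx mx)).integral_x_lower cf cs
  have t20 := (hLx.mulVec (h20.comp_continuous hzx mx)).integral_x_upper cf cs
  have t01 := (hLy.mulVec (h01.comp_continuous hzy my)).integral_y_lower cf cs
  have t02 := (hLy.mulVec (h02.comp_continuous hzy my)).integral_y_upper cf cs
  have t11 := ((hLxy.mulVec (h11.comp_continuous hzxy mxy)).integral_y_lower cw cy).integral_x_lower
    cf cs
  have t21 := ((hLxy.mulVec (h21.comp_continuous hzxy mxy)).integral_y_lower cw cy).integral_x_upper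
    cf cs
  have t12 := ((hLxy.mulVec (h12.comp_continuous hzxy mxy)).integral_y_upper cw cy).integral_x_lower
    cf cs
  have t22 := ((hLxy.mulVec (h22.comp_continuous hzxy mxy)).integral_y_upper cw cy).integral_x_upper
    cf cs
  exact (((((((t00.add t10).add t20).add t01).add t02).add t11).add t21).add t12).add t22

end Clamp

/-- Composition of a (011→2D)-PI operator followed by a 2D-PI operator
is a (011→2D)-PI operator. -/
theorem composition_2D_after_011to2D {n2 p2 m0 m1 : ℕ} (a b c d : ℝ)
    (hab : a < b) (hcd : c < d)
    (N : PI2DK n2 p2) (E : PI011to2DK p2 m0 m1)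
    (hN : N.IsCont a b c d) (hE : E.IsCont a b c d) :
    ∃ T : PI011to2DK n2 m0 m1, T.IsCont a b c d ∧
      ∀ (v : Fin m0 → ℝ) (u1 u2 : ℝ → Fin m1 → ℝ),
        ContinuousOn u1 (Icc a b) → ContinuousOn u2 (Icc c d) →
        ∀ x ∈ Icc a b, ∀ y ∈ Icc c d,
          PI2D a b c d N (PI011to2D a b c d E v u1 u2) x y
            = PI011to2D a b c d T v u1 u2 x y := by
  obtain ⟨T, hT, h⟩ := ((isParamPI011_PI011to2D_clamp hE hab.le hcd.le).PI2D_clamp hN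
    hab.le hcd.le).exists_kernels
  refine ⟨T, hT, fun v u1 u2 hu1 hu2 x hx y hy => ?_⟩
  have e1 : EqOn u1 (u1 ∘ clampIcc a b) (Icc a b) := fun x hx => by
    simp only [Function.comp, clampIcc_of_mem hx]
  have e2 : EqOn u2 (u2 ∘ clampIcc c d) (Icc c d) := fun y hy => by
    simp only [Function.comp, clampIcc_of_mem hy]
  rw [PI011to2D_congr T v e1 e2 hx hy,
    ← h v _ _ (hu1.comp_continuous continuous_clampIcc (clampIcc_mem hab.le))
      (hu2.comp_continuous continuous_clampIcc (clampIcc_mem hcd.le))]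
  exact PI2D_clamp_congr N hx hy fun x hx y hy =>
    (PI011to2D_congr E v e1 e2 hx hy).trans (PI011to2D_clamp E v _ _ hx hy).symm
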